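/- Assume q > 0, and let j ≥ 0 be such that 2β_j·b_j < q, 2β_{j+2}·b_{j+2} < q, and 2β_{j+1}·b_{j+1} ≥ q. Then the symmetric 2×2 rational matrix with diagonal entries 2β_j·b_j/q − 1 and 2β_{j+2}·b_{j+2}/q − 1 and off-diagonal entries (β_{j+2}·b_j + β_j·b_{j+2})/q − 1 is negative semidefinite. -/

import Mathlib

/-- Assume `q > 0` and let `j ≥ 0` be such that `2βⱼbⱼ < q`, `2βⱼ₊₂bⱼ₊₂ < q`
and `2βⱼ₊₁bⱼ₊₁ ≥ q`. Then the symmetric 2×2 rational matrix with diagonal entries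
`2βⱼbⱼ/q − 1`, `2βⱼ₊₂bⱼ₊₂/q − 1` and off-diagonal entries
`(βⱼ₊₂bⱼ + βⱼbⱼ₊₂)/q − 1` is negative semidefinite. -/
theorem intersection_matrix_negSemidef (p q : ℤ) (c a b β : ℤ → ℤ)
    (ha₀ : a (-1) = 0) (ha₁ : a 0 = 1)
    (hb₀ : b (-1) = 1) (hb₁ : b 0 = 0)
    (ha : ∀ i : ℤ, 1 ≤ i → a i = c i * a (i - 1) + a (i - 2))
    (hb : ∀ i : ℤ, 1 ≤ i → b i = c i * b (i - 1) + b (i - 2))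
    (hβ : ∀ i : ℤ, -1 ≤ i → β i = (Int.negOnePow i : ℤ) * (a i * q - b i * p))
    (hq : 0 < q) (j : ℤ) (hj : 0 ≤ j)
    (h₁ : 2 * β j * b j < q)
    (h₂ : 2 * β (j + 2) * b (j + 2) < q)
    (h₃ : q ≤ 2 * β (j + 1) * b (j + 1)) :
    ∀ x : Fin 2 → ℚ,
      dotProduct x
        ((Matrix.of
          ![![2 * (β j : ℚ) * (b j : ℚ) / (q : ℚ) - 1,
              ((β (j + 2) : ℚ) * (b j : ℚ) + (β j : ℚ) * (b (j + 2) : ℚ)) / (q : ℚ) - 1],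
            ![((β (j + 2) : ℚ) * (b j : ℚ) + (β j : ℚ) * (b (j + 2) : ℚ)) / (q : ℚ) - 1,
              2 * (β (j + 2) : ℚ) * (b (j + 2) : ℚ) / (q : ℚ) - 1]]).mulVec x) ≤ 0 := by
  have hrec : ∀ i : ℤ, -1 ≤ i → β (i + 2) = β i - c (i + 2) * β (i + 1) := by
    intro i hi
    have e1 := ha (i + 2) (by omega)
    have e2 := hb (i + 2) (by omega)
    rw [show i + 2 - 1 = i + 1 by ring, show i + 2 - 2 = i by ring] at e1 e2
    rw [hβ (i + 2) (by omega), hβ i hi, hβ (i + 1) (by omega), e1, e2,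
      show i + 2 = i + 1 + 1 by ring, Int.negOnePow_succ, Int.negOnePow_succ]
    push_cast
    ring
  have hbrec : ∀ i : ℤ, -1 ≤ i → b (i + 2) = b i + c (i + 2) * b (i + 1) := by
    intro i hi
    have e2 := hb (i + 2) (by omega)
    rw [show i + 2 - 1 = i + 1 by ring, show i + 2 - 2 = i by ring] at e2
    rw [e2]; ring
  have hinv : ∀ i : ℤ, -1 ≤ i → β i * b (i + 1) + β (i + 1) * b i = q := by
    intro i hi
    induction i, hi using Int.le_induction with
    | base =>
      have h0 := hβ 0 (by norm_num)
      simp [ha₁, hb₁] at h0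
      simp [hb₀, hb₁, h0]
    | succ i hi ih =>
      rw [show i + 1 + 1 = i + 2 by ring, hrec i hi, hbrec i hi]
      linear_combination ih
  intro x
  have I := hinv j (by omega)
  have R1 := hrec j (by omega)
  have R2 := hbrec j (by omega)
  rw [R1, R2]
  generalize β (j + 1) = Γ at *
  generalize b (j + 1) = B at *
  generalize β j = γ at *
  generalize b j = d at *
  generalize c (j + 2) = k at *
  have hqQ : (0 : ℚ) < q := by exact_mod_cast hq
  have h3Q : (q : ℚ) ≤ 2 * Γ * B := by exact_mod_cast h₃
  have IQ : (γ : ℚ) * B + Γ * d = q := by exact_mod_cast I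
  simp only [dotProduct, Matrix.mulVec, Fin.sum_univ_two, Matrix.of_apply, Matrix.cons_val_zero,
    Matrix.cons_val_one]
  push_cast
  have hG : (0 : ℚ) < 2 * Γ * B * q := mul_pos (by linarith) hqQ
  refine nonpos_of_mul_nonpos_right (a := 2 * (Γ : ℚ) * B * q) ?_ hG
  have key : (x 0 + x 1) ^ 2 * (q * (2 * Γ * B - q)) ≥ (0 : ℚ) :=
    mul_nonneg (sq_nonneg _) (mul_nonneg hqQ.le (by linarith))
  have key2 := sq_nonneg
    (2 * (Γ : ℚ) * B * (k * x 1) - (γ * B - Γ * d) * (x 0 + x 1))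
  refine le_of_eq_of_le (b := -(2 * (Γ : ℚ) * B * (k * x 1) - (γ * B - Γ * d) * (x 0 + x 1)) ^ 2
    - (x 0 + x 1) ^ 2 * (q * (2 * Γ * B - q))) ?_ (by linarith)
  field_simp
  linear_combination (x 0 + x 1) ^ 2 * ((γ : ℚ) * B + Γ * d + q) * IQ
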